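/- Let (μ_t)_{t∈[0,1]} be a right-continuous peacock and Q ⊂ [0,1] countable dense with 1 ∈ Q. Then restriction of paths to Q induces a bijection between the set M((μ_t)_{t∈[0,1]}) of càdlàg martingale measures on Skorokhod space D with marginals (μ_t)_{t∈[0,1]} and the set M((μ_t)_{t∈Q}) of martingale measures on ℝ^Q with marginals (μ_t)_{t∈Q}. -/

import Mathlib

open MeasureTheory Set Filter Topology

/-- The convex order on probability measures on `ℝ`. -/
def ConvexOrder (μ ν : Measure ℝ) : Prop :=
  ∀ φ : ℝ → ℝ, ConvexOn ℝ Set.univ φ → Integrable φ μ → Integrable φ ν →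
    ∫ x, φ x ∂μ ≤ ∫ x, φ x ∂ν

/-- `g` is càdlàg on `[0,1]`. -/
def CadlagOn01 (g : ℝ → ℝ) : Prop :=
  (∀ x ∈ Ico (0 : ℝ) 1, Tendsto g (𝓝[>] x) (𝓝 (g x))) ∧
  (∀ x ∈ Ioc (0 : ℝ) 1, ∃ L : ℝ, Tendsto g (𝓝[<] x) (𝓝 L))

/-- The Skorokhod-type space of càdlàg paths `[0,1] → ℝ` (realized inside `ℝ → ℝ`). -/
def Dspace : Type := {g : ℝ → ℝ // CadlagOn01 g}

/-- The canonical σ-algebra on `D`, generated by the evaluations `S_t`, `t ∈ [0,1]`. -/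
noncomputable instance : MeasurableSpace Dspace :=
  ⨆ t ∈ Icc (0 : ℝ) 1, MeasurableSpace.comap (fun g : Dspace => g.1 t) inferInstance

/-- The natural filtration `F_t` on `D`. -/
noncomputable def FD (t : ℝ) : MeasurableSpace Dspace :=
  ⨆ r ∈ Icc (0 : ℝ) t, MeasurableSpace.comap (fun g : Dspace => g.1 r) inferInstance

/-- The right-continuous filtration `F⁺` on `D`. -/
noncomputable def FDplus (s : ℝ) : MeasurableSpace Dspace :=
  if s = 1 then FD 1 else ⨅ t ∈ Ioc s (1 : ℝ), FD t

/-- The set `M((μ_t)_{t∈[0,1]})` of càdlàg martingale measures (w.r.t. `F⁺`)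
with marginals `(μ_t)_{t ∈ [0,1]}`. -/
def MI (μ : ℝ → ProbabilityMeasure ℝ) : Set (Measure Dspace) :=
  {P | IsProbabilityMeasure P ∧
    (∀ t ∈ Icc (0 : ℝ) 1, P.map (fun g : Dspace => g.1 t) = (μ t : Measure ℝ)) ∧
    (∀ t ∈ Icc (0 : ℝ) 1, Integrable (fun g : Dspace => g.1 t) P) ∧
    (∀ s t : ℝ, 0 ≤ s → s ≤ t → t ≤ 1 →
      P[(fun g : Dspace => g.1 t) | FDplus s] =ᵐ[P] fun g : Dspace => g.1 s)}

/-- The natural filtration of the canonical process on `ℝ^Q`. -/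
noncomputable def natFiltration (Q : Type*) [Preorder Q] :
    Filtration Q (MeasurableSpace.pi : MeasurableSpace (Q → ℝ)) where
  seq i := ⨆ t ∈ Set.Iic i, MeasurableSpace.comap (fun ω : Q → ℝ => ω t) inferInstance
  mono' i j hij := by
    refine iSup_le fun t => iSup_le fun ht => ?_
    exact le_iSup₂ (f := fun (t : Q) (_ : t ∈ Set.Iic j) =>
      MeasurableSpace.comap (fun ω : Q → ℝ => ω t) inferInstance) t (ht.trans hij)
  le' i := by
    refine iSup_le fun t => iSup_le fun _ => ?_
    exact (measurable_pi_apply t).comap_le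

/-- The set `M((μ_t)_{t∈Q})` of martingale measures on `ℝ^Q` with marginals `(μ_t)_{t∈Q}`. -/
def MQ (Q : Set ℝ) (μ : ℝ → ProbabilityMeasure ℝ) : Set (Measure (↥Q → ℝ)) :=
  {P | IsProbabilityMeasure P ∧
    Martingale (fun (t : ↥Q) (ω : ↥Q → ℝ) => ω t) (natFiltration ↥Q) P ∧
    ∀ t : ↥Q, P.map (fun ω => ω t) = (μ (t : ℝ) : Measure ℝ)}

section Regularity

variable {ι : Type*} [LinearOrder ι]

/-- `k` strict alternations (`< a` then `> b`) of `f` along points of `F`, all before `h`. -/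
def UpAlt (f : ι → ℝ) (a b : ℝ) (F : Set ι) : ℕ → ι → Prop
  | 0, _ => True
  | k + 1, h => ∃ q ∈ F, ∃ r ∈ F, q < r ∧ r < h ∧ f q < a ∧ b < f r ∧ UpAlt f a b F k q

lemma UpAlt.mono {f : ι → ℝ} {a b : ℝ} {F G : Set ι} (hFG : F ⊆ G) :
    ∀ {k : ℕ} {h h' : ι}, h ≤ h' → UpAlt f a b F k h → UpAlt f a b G k h'
  | 0, _, _, _, _ => trivial
  | k + 1, h, h', hh, ⟨q, hq, r, hr, hqr, hrh, h1, h2, h3⟩ =>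
    ⟨q, hFG hq, r, hFG hr, hqr, hrh.trans_le hh, h1, h2, UpAlt.mono hFG le_rfl h3⟩

lemma UpAlt.exists_finset {f : ι → ℝ} {a b : ℝ} :
    ∀ {k : ℕ} {h : ι}, UpAlt f a b univ k h → ∃ F : Finset ι, UpAlt f a b (F : Set ι) k h
  | 0, _, _ => ⟨∅, trivial⟩
  | k + 1, h, ⟨q, _, r, _, hqr, hrh, h1, h2, h3⟩ => by
    classical
    obtain ⟨F, hF⟩ := UpAlt.exists_finset h3
    refine ⟨insert q (insert r F), q, by simp, r, by simp, hqr, hrh, h1, h2, ?_⟩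
    refine UpAlt.mono ?_ le_rfl hF
    intro x hx
    simp only [Finset.coe_insert]
    exact Or.inr (Or.inr hx)

lemma UpAlt.le_upcrossings {Ω : Type*} {X : ι → Ω → ℝ} {ω : Ω} {a b : ℝ} (hab : a < b)
    {F : Set ι} {u : ℕ → ι} (hu : Monotone u) (hF : ∀ q ∈ F, ∃ j, u j = q) :
    ∀ {k : ℕ} {h : ι} {M : ℕ}, UpAlt (fun q => X q ω) a b F k h →
      (∀ r ∈ F, r < h → ∃ j < M, u j = r) →
      k ≤ upcrossingsBefore a b (fun n => X (u n)) M ω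
  | 0, _, _, _, _ => Nat.zero_le _
  | k + 1, h, M, ⟨q, hq, r, hr, hqr, hrh, h1, h2, h3⟩, hM => by
    obtain ⟨j, hjM, rfl⟩ := hM r hr hrh
    obtain ⟨i, rfl⟩ := hF q hq
    have hij : i < j := by
      by_contra hc
      exact absurd (hu (not_lt.mp hc)) (not_le.mpr hqr)
    have ih := UpAlt.le_upcrossings (X := X) (ω := ω) (M := i) hab hu hF h3 (by
      intro r' hr' hlt
      obtain ⟨j', rfl⟩ := hF r' hr'
      refine ⟨j', ?_, rfl⟩
      by_contra hc
      exact absurd (hu (not_lt.mp hc)) (not_le.mpr hlt))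
    have h4 := upcrossingsBefore_lt_of_exists_upcrossing (f := fun n => X (u n)) (ω := ω) hab
      (le_refl i) h1 hij.le h2
    have h5 := upcrossingsBefore_mono (f := fun n => X (u n)) hab (Nat.succ_le_of_lt hjM) ω
    simp only [Nat.succ_eq_add_one] at h5
    omega

lemma exists_mono_enum {T : ι} (hT : ∀ q, q ≤ T) (F : Finset ι) :
    ∃ (u : ℕ → ι) (n : ℕ), Monotone u ∧ (∀ k, n ≤ k → u k = T) ∧ ∀ q ∈ F, ∃ k < n, u k = q := by
  classical
  let l := F.sort (· ≤ ·)
  refine ⟨fun k => l.getD k T, l.length, ?_, ?_, ?_⟩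
  · intro i j hij
    simp only
    by_cases hj : j < l.length
    · have hi : i < l.length := hij.trans_lt hj
      rw [List.getD_eq_getElem _ _ hi, List.getD_eq_getElem _ _ hj]
      exact (Finset.pairwise_sort F (· ≤ ·)).sortedLE.monotone_get (a := ⟨i, hi⟩) (b := ⟨j, hj⟩) hij
    · rw [List.getD_eq_default (n := j) _ _ (not_lt.mp hj)]
      exact hT _
  · intro k hk
    exact List.getD_eq_default _ _ hk
  · intro q hq
    have : q ∈ l := (Finset.mem_sort _).2 hq
    obtain ⟨k, hk, rfl⟩ := List.getElem_of_mem this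
    exact ⟨k, hk, List.getD_eq_getElem _ _ hk⟩

variable {Ω : Type*} {m0 : MeasurableSpace Ω} {P : Measure Ω} [IsProbabilityMeasure P]
  {ℱ : Filtration ι m0} {X : ι → Ω → ℝ}

/-- Time change of a filtration. -/
def filtComp (ℱ : Filtration ι m0) (u : ℕ → ι) (hu : Monotone u) : Filtration ℕ m0 where
  seq n := ℱ (u n)
  mono' _ _ hij := ℱ.mono (hu hij)
  le' n := ℱ.le (u n)

lemma martingale_comp (hX : Martingale X ℱ P) {u : ℕ → ι} (hu : Monotone u) :
    Martingale (fun n => X (u n)) (filtComp ℱ u hu) P :=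
  ⟨fun n => hX.1 (u n), fun _ _ hij => hX.2 _ _ (hu hij)⟩

lemma prob_upAlt_finset_le (hX : Martingale X ℱ P) {T : ι} (hT : ∀ q, q ≤ T) {a b : ℝ}
    (hab : a < b) (k : ℕ) (F : Finset ι) :
    ENNReal.ofReal ((b - a) * k) * P {ω | ∃ h, UpAlt (fun q => X q ω) a b (F : Set ι) k h} ≤
      ENNReal.ofReal (∫ ω, (X T ω - a)⁺ ∂P) := by
  obtain ⟨u, n, hu, huT, huF⟩ := exists_mono_enum hT F
  have hM := martingale_comp hX hu
  have h1 := hM.submartingale.mul_integral_upcrossingsBefore_le_integral_pos_part a b n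
  simp only [huT n le_rfl] at h1
  have hint := hM.1.integrable_upcrossingsBefore (μ := P) (N := n) hab
  have h2 := mul_meas_ge_le_integral_of_nonneg (μ := P)
    (f := fun ω => (upcrossingsBefore a b (fun n => X (u n)) n ω : ℝ))
    (Eventually.of_forall fun _ => Nat.cast_nonneg _) hint k
  have hsub : {ω | ∃ h, UpAlt (fun q => X q ω) a b (F : Set ι) k h} ⊆
      {ω | (k : ℝ) ≤ (upcrossingsBefore a b (fun n => X (u n)) n ω : ℝ)} := by
    rintro ω ⟨h, hh⟩
    have := UpAlt.le_upcrossings (X := X) (ω := ω) (M := n) hab hu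
      (fun q hq => (huF q hq).imp fun _ h => h.2) hh (fun r hr _ => huF r hr)
    exact_mod_cast this
  have hba : 0 ≤ b - a := by linarith
  have h3 : (b - a) * (k * P.real {ω | ∃ h, UpAlt (fun q => X q ω) a b (F : Set ι) k h}) ≤
      ∫ ω, (X T ω - a)⁺ ∂P := by
    refine le_trans ?_ h1
    refine mul_le_mul_of_nonneg_left (le_trans ?_ h2) hba
    exact mul_le_mul_of_nonneg_left (measureReal_mono hsub) (Nat.cast_nonneg _)
  rw [← mul_assoc] at h3
  have h4 := ENNReal.ofReal_le_ofReal h3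
  rwa [ENNReal.ofReal_mul (by positivity), ofReal_measureReal] at h4

lemma ennreal_eq_zero_of_nat_mul_le {x C : ENNReal} {d : ℝ} (hd : 0 < d) (hC : C ≠ ⊤)
    (h : ∀ k : ℕ, ENNReal.ofReal (d * k) * x ≤ C) : x = 0 := by
  by_contra hx
  have ht : Tendsto (fun k : ℕ => ENNReal.ofReal (d * k) * x) atTop (𝓝 ⊤) := by
    have h1 : Tendsto (fun k : ℕ => ENNReal.ofReal (d * k)) atTop (𝓝 ⊤) :=
      ENNReal.tendsto_ofReal_atTop.comp
        (Tendsto.const_mul_atTop hd tendsto_natCast_atTop_atTop)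
    have h2 := ENNReal.Tendsto.mul_const (b := x) h1 (Or.inl (by simp))
    rwa [ENNReal.top_mul hx] at h2
  exact hC (top_le_iff.mp (le_of_tendsto' ht h))

lemma prob_upAlt_all [Countable ι] (hX : Martingale X ℱ P) {T : ι} (hT : ∀ q, q ≤ T) {a b : ℝ}
    (hab : a < b) :
    ∀ᵐ ω ∂P, ∃ k, ∀ h, ¬ UpAlt (fun q => X q ω) a b univ k h := by
  rw [ae_iff]
  refine ennreal_eq_zero_of_nat_mul_le (d := b - a) (by linarith)
    (C := ENNReal.ofReal (∫ ω, (X T ω - a)⁺ ∂P)) (by simp) fun k => ?_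
  have hsub : {ω | ¬ ∃ k, ∀ h, ¬ UpAlt (fun q => X q ω) a b univ k h} ⊆
      ⋃ F : Finset ι, {ω | ∃ h, UpAlt (fun q => X q ω) a b (F : Set ι) k h} := by
    intro ω hω
    simp only [mem_setOf_eq, not_exists, not_forall, not_not] at hω
    obtain ⟨h, hh⟩ := hω k
    obtain ⟨F, hF⟩ := UpAlt.exists_finset hh
    exact mem_iUnion.2 ⟨F, h, hF⟩
  refine le_trans (mul_le_mul_right (measure_mono hsub) _) ?_
  rw [Directed.measure_iUnion]
  · rw [ENNReal.mul_iSup]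
    exact iSup_le fun F => prob_upAlt_finset_le hX hT hab k F
  · refine Monotone.directed_le ?_
    rintro F G hFG ω ⟨h, hh⟩
    exact ⟨h, UpAlt.mono (Finset.coe_subset.2 hFG) le_rfl hh⟩

lemma prob_bdd_finset_le (hX : Martingale X ℱ P) {T : ι} (hT : ∀ q, q ≤ T) (k : ℕ)
    (F : Finset ι) :
    (k : ENNReal) * P {ω | ∃ q ∈ F, (k : ℝ) ≤ |X q ω|} ≤ ENNReal.ofReal (∫ ω, |X T ω| ∂P) := by
  obtain ⟨u, n, hu, huT, huF⟩ := exists_mono_enum hT F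
  have hM := martingale_comp hX hu
  have hS : Submartingale (fun n ω => |X (u n) ω|) (filtComp ℱ u hu) P := by
    have := hM.submartingale.sup hM.neg.submartingale
    exact this
  have h1 := maximal_ineq (ε := (k : NNReal)) hS (fun _ _ => abs_nonneg _) n
  simp only [huT n le_rfl] at h1
  refine le_trans ?_ (h1.trans (ENNReal.ofReal_le_ofReal ?_))
  · simp only [ENNReal.coe_natCast, NNReal.coe_natCast]
    refine mul_le_mul_right (measure_mono ?_) _
    rintro ω ⟨q, hq, hk⟩
    obtain ⟨j, hj, rfl⟩ := huF q hq
    exact le_trans hk (Finset.le_sup' (fun k => |X (u k) ω|) (Finset.mem_range.2 (by omega)))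
  · exact setIntegral_le_integral (hX.integrable T).abs (Eventually.of_forall fun _ => abs_nonneg _)

lemma prob_bdd_all [Countable ι] (hX : Martingale X ℱ P) {T : ι} (hT : ∀ q, q ≤ T) :
    ∀ᵐ ω ∂P, ∃ C : ℝ, ∀ q, |X q ω| ≤ C := by
  rw [ae_iff]
  refine ennreal_eq_zero_of_nat_mul_le (d := 1) (by linarith)
    (C := ENNReal.ofReal (∫ ω, |X T ω| ∂P)) (by simp) fun k => ?_
  have hsub : {ω | ¬ ∃ C : ℝ, ∀ q, |X q ω| ≤ C} ⊆
      ⋃ F : Finset ι, {ω | ∃ q ∈ F, (k : ℝ) ≤ |X q ω|} := by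
    intro ω hω
    simp only [mem_setOf_eq, not_exists, not_forall, not_le] at hω
    obtain ⟨q, hq⟩ := hω k
    exact mem_iUnion.2 ⟨{q}, q, by simp, hq.le⟩
  refine le_trans (mul_le_mul_right (measure_mono hsub) _) ?_
  rw [Directed.measure_iUnion]
  · rw [ENNReal.mul_iSup]
    refine iSup_le fun F => ?_
    simpa using prob_bdd_finset_le hX hT k F
  · refine Monotone.directed_le ?_
    rintro F G hFG ω ⟨q, hq, hh⟩
    exact ⟨q, hFG hq, hh⟩

lemma ae_no_upcrossings [Countable ι] (hX : Martingale X ℱ P) {T : ι} (hT : ∀ q, q ≤ T) :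
    ∀ᵐ ω ∂P, (∃ C : ℝ, ∀ q, |X q ω| ≤ C) ∧
      ∀ a b : ℚ, a < b → ∃ k, ∀ h, ¬ UpAlt (fun q => X q ω) (a : ℝ) (b : ℝ) univ k h := by
  refine (prob_bdd_all hX hT).and ?_
  rw [ae_all_iff]
  intro a
  rw [ae_all_iff]
  intro b
  by_cases hab : a < b
  · filter_upwards [prob_upAlt_all hX hT (a := a) (b := b) (by exact_mod_cast hab)] with ω h _
    exact h
  · exact Eventually.of_forall fun _ h => absurd h hab

end Regularity
section Paths

variable {Q : Set ℝ}

lemma exists_Q_between (hd : Icc (0 : ℝ) 1 ⊆ closure Q) {a b : ℝ} (ha : 0 ≤ a) (hab : a < b)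
    (hb : b ≤ 1) : ∃ q : ↥Q, a < q ∧ (q : ℝ) < b := by
  have hm : (a + b) / 2 ∈ closure Q := hd ⟨by linarith, by linarith⟩
  obtain ⟨x, hx, hxQ⟩ := mem_closure_iff.1 hm (Ioo a b) isOpen_Ioo ⟨by linarith, by linarith⟩
  exact ⟨⟨x, hxQ⟩, hx.1, hx.2⟩

/-- Right neighbourhood filter on `Q`. -/
def rFil (Q : Set ℝ) (t : ℝ) : Filter ↥Q := comap (Subtype.val : ↥Q → ℝ) (𝓝[>] t)

/-- Left neighbourhood filter on `Q`. -/
def lFil (Q : Set ℝ) (t : ℝ) : Filter ↥Q := comap (Subtype.val : ↥Q → ℝ) (𝓝[<] t)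

lemma rFil_neBot (hd : Icc (0 : ℝ) 1 ⊆ closure Q) {t : ℝ} (ht : t ∈ Ico (0 : ℝ) 1) :
    (rFil Q t).NeBot := by
  refine comap_neBot fun s hs => ?_
  obtain ⟨u, hu, hus⟩ := (mem_nhdsGT_iff_exists_Ioo_subset' ht.2).1 hs
  obtain ⟨q, h1, h2⟩ := exists_Q_between hd ht.1 (lt_min hu ht.2) (min_le_right u 1)
  exact ⟨q, hus ⟨h1, h2.trans_le (min_le_left _ _)⟩⟩

lemma lFil_neBot (hd : Icc (0 : ℝ) 1 ⊆ closure Q) {t : ℝ} (ht : t ∈ Ioc (0 : ℝ) 1) :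
    (lFil Q t).NeBot := by
  refine comap_neBot fun s hs => ?_
  obtain ⟨u, hu, hus⟩ := (mem_nhdsLT_iff_exists_Ioo_subset' ht.1).1 hs
  obtain ⟨q, h1, h2⟩ := exists_Q_between hd (le_max_right u 0) (max_lt hu ht.1) ht.2
  exact ⟨q, hus ⟨(le_max_left _ _).trans_lt h1, h2⟩⟩

lemma rFil_Ioo {t u : ℝ} (h : t < u) : ∀ᶠ q : ↥Q in rFil Q t, t < (q : ℝ) ∧ (q : ℝ) < u :=
  preimage_mem_comap (Ioo_mem_nhdsGT h)

lemma lFil_Ioo {t u : ℝ} (h : u < t) : ∀ᶠ q : ↥Q in lFil Q t, u < (q : ℝ) ∧ (q : ℝ) < t :=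
  preimage_mem_comap (Ioo_mem_nhdsLT h)

lemma exists_seq_right (hd : Icc (0 : ℝ) 1 ⊆ closure Q) {t u : ℝ} (ht : t ∈ Ico (0 : ℝ) 1)
    (hu : t < u) : ∃ q : ℕ → ↥Q, (∀ n, t < q n ∧ (q n : ℝ) < u) ∧
      Tendsto q atTop (rFil Q t) ∧ Tendsto (fun n => (q n : ℝ)) atTop (𝓝[>] t) := by
  have := rFil_neBot hd ht
  have hc : (rFil Q t).IsCountablyGenerated := by unfold rFil; infer_instance
  obtain ⟨q, hq⟩ := (rFil Q t).exists_seq_tendsto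
  obtain ⟨N, hN⟩ := eventually_atTop.1 (hq.eventually (rFil_Ioo hu))
  have h2 : Tendsto (fun n => q (n + N)) atTop (rFil Q t) := hq.comp (tendsto_add_atTop_nat N)
  exact ⟨fun n => q (n + N), fun n => hN (n + N) (Nat.le_add_left _ _), h2, tendsto_comap.comp h2⟩

/-- A function on `Q` with left and right limits. -/
def GoodPath (Q : Set ℝ) (f : ↥Q → ℝ) : Prop :=
  (∀ t ∈ Ico (0 : ℝ) 1, ∃ L, Tendsto f (rFil Q t) (𝓝 L)) ∧
  (∀ t ∈ Ioc (0 : ℝ) 1, ∃ L, Tendsto f (lFil Q t) (𝓝 L))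

lemma goodPath_of (hd : Icc (0 : ℝ) 1 ⊆ closure Q) {f : ↥Q → ℝ}
    (hb : ∃ C : ℝ, ∀ q, |f q| ≤ C)
    (hu : ∀ a b : ℚ, a < b → ∃ k, ∀ h, ¬ UpAlt f (a : ℝ) (b : ℝ) univ k h) :
    GoodPath Q f := by
  obtain ⟨C, hC⟩ := hb
  have hdense : Dense (range ((↑) : ℚ → ℝ)) := Rat.denseRange_cast
  have hb1 : ∀ l : Filter ↥Q, l.IsBoundedUnder (· ≤ ·) f := fun l =>
    isBoundedUnder_of ⟨C, fun q => (abs_le.1 (hC q)).2⟩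
  have hb2 : ∀ l : Filter ↥Q, l.IsBoundedUnder (· ≥ ·) f := fun l =>
    isBoundedUnder_of ⟨-C, fun q => (abs_le.1 (hC q)).1⟩
  constructor
  · intro t ht
    have := rFil_neBot hd ht
    refine tendsto_of_no_upcrossings hdense ?_ (hb1 _) (hb2 _)
    rintro _ ⟨a, rfl⟩ _ ⟨b, rfl⟩ hab ⟨h1, h2⟩
    obtain ⟨k, hk⟩ := hu a b (by exact_mod_cast hab)
    have key : ∀ k, ∀ h : ↥Q, t < h → UpAlt f (a : ℝ) (b : ℝ) univ k h := by
      intro k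
      induction k with
      | zero => intro _ _; trivial
      | succ k ih =>
        intro h hh
        obtain ⟨r, hr, hr1, hr2⟩ := (h2.and_eventually (rFil_Ioo hh)).exists
        obtain ⟨q, hq, hq1, hq2⟩ := (h1.and_eventually (rFil_Ioo hr1)).exists
        exact ⟨q, mem_univ _, r, mem_univ _, hq2, hr2, hq, hr, ih q hq1⟩
    obtain ⟨q, hq1, _⟩ := (rFil_Ioo (Q := Q) ht.2).exists
    exact hk q (key k q hq1)
  · intro t ht
    have := lFil_neBot hd ht
    refine tendsto_of_no_upcrossings hdense ?_ (hb1 _) (hb2 _)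
    rintro _ ⟨a, rfl⟩ _ ⟨b, rfl⟩ hab ⟨h1, h2⟩
    obtain ⟨k, hk⟩ := hu a b (by exact_mod_cast hab)
    have key : ∀ k, ∃ h : ↥Q, (h : ℝ) < t ∧ UpAlt f (a : ℝ) (b : ℝ) univ k h := by
      intro k
      induction k with
      | zero =>
        obtain ⟨q, _, hq2⟩ := (lFil_Ioo (Q := Q) ht.1).exists
        exact ⟨q, hq2, trivial⟩
      | succ k ih =>
        obtain ⟨h, hh, hup⟩ := ih
        obtain ⟨q, hq, hq1, hq2⟩ := (h1.and_eventually (lFil_Ioo hh)).exists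
        obtain ⟨r, hr, hr1, hr2⟩ := (h2.and_eventually (lFil_Ioo hq2)).exists
        obtain ⟨h', hh1, hh2⟩ := (lFil_Ioo (Q := Q) hr2).exists
        exact ⟨h', hh2, q, mem_univ _, r, mem_univ _, hr1, hh1, hq, hr,
          UpAlt.mono subset_rfl (le_of_lt hq1) hup⟩
    obtain ⟨h, _, hh⟩ := key k
    exact hk h hh

open Classical in
/-- The càdlàg regularization of a function on `Q`. -/
noncomputable def regPath (Q : Set ℝ) (h1 : (1 : ℝ) ∈ Q) (f : ↥Q → ℝ) (t : ℝ) : ℝ :=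
  if t < 1 then limUnder (rFil Q t) f else f ⟨1, h1⟩

lemma regPath_tendsto (h1 : (1 : ℝ) ∈ Q) {f : ↥Q → ℝ}
    (hf : GoodPath Q f) {t : ℝ} (ht : t ∈ Ico (0 : ℝ) 1) :
    Tendsto f (rFil Q t) (𝓝 (regPath Q h1 f t)) := by
  rw [regPath, if_pos ht.2]
  exact tendsto_nhds_limUnder (hf.1 t ht)

lemma regPath_cadlag (hd : Icc (0 : ℝ) 1 ⊆ closure Q) (h1 : (1 : ℝ) ∈ Q) {f : ↥Q → ℝ}
    (hf : GoodPath Q f) : CadlagOn01 (regPath Q h1 f) := by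
  constructor
  · intro t ht
    have ht' := regPath_tendsto h1 hf ht
    rw [Metric.tendsto_nhds] at ht' ⊢
    intro ε hε
    have h2 := ht' (ε / 2) (by linarith)
    obtain ⟨s, hs, hsub⟩ := mem_comap.1 h2
    obtain ⟨u, hu, hus⟩ := (mem_nhdsGT_iff_exists_Ioo_subset' ht.2).1 hs
    filter_upwards [Ioo_mem_nhdsGT (lt_min hu ht.2)] with x hx
    have hx1 : x ∈ Ico (0 : ℝ) 1 := ⟨ht.1.trans hx.1.le, hx.2.trans_le (min_le_right _ _)⟩
    have := rFil_neBot hd hx1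
    have h3 : dist (regPath Q h1 f x) (regPath Q h1 f t) ≤ ε / 2 := by
      refine le_of_tendsto ((regPath_tendsto h1 hf hx1).dist tendsto_const_nhds) ?_
      filter_upwards [rFil_Ioo (hx.2.trans_le (min_le_left _ _))] with q hq
      exact le_of_lt (hsub (hus ⟨hx.1.trans hq.1, hq.2⟩ : (q : ℝ) ∈ s))
    linarith
  · intro t ht
    obtain ⟨L, hL⟩ := hf.2 t ht
    refine ⟨L, ?_⟩
    rw [Metric.tendsto_nhds] at hL ⊢
    intro ε hε
    have h2 := hL (ε / 2) (by linarith)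
    obtain ⟨s, hs, hsub⟩ := mem_comap.1 h2
    obtain ⟨u, hu, hus⟩ := (mem_nhdsLT_iff_exists_Ioo_subset' ht.1).1 hs
    filter_upwards [Ioo_mem_nhdsLT (max_lt hu ht.1)] with x hx
    have hx1 : x ∈ Ico (0 : ℝ) 1 :=
      ⟨((le_max_right _ _).trans_lt hx.1).le, hx.2.trans_le ht.2⟩
    have := rFil_neBot hd hx1
    have h3 : dist (regPath Q h1 f x) L ≤ ε / 2 := by
      refine le_of_tendsto ((regPath_tendsto h1 hf hx1).dist tendsto_const_nhds) ?_
      filter_upwards [rFil_Ioo hx.2] with q hq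
      exact le_of_lt (hsub (hus ⟨((le_max_left _ _).trans_lt hx.1).trans hq.1, hq.2⟩ : (q : ℝ) ∈ s))
    linarith

lemma dspace_tendsto (g : Dspace) {t : ℝ} (ht : t ∈ Ico (0 : ℝ) 1) :
    Tendsto g.1 (𝓝[>] t) (𝓝 (g.1 t)) := g.2.1 t ht

end Paths

section SigmaAlg

variable {Q : Set ℝ}

/-- Restriction to `Q`. -/
def restr (Q : Set ℝ) (g : Dspace) (q : ↥Q) : ℝ := g.1 q

lemma measurable_eval {t : ℝ} (ht : t ∈ Icc (0 : ℝ) 1) : Measurable (fun g : Dspace => g.1 t) := by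
  rw [measurable_iff_comap_le]
  exact le_iSup₂ (f := fun (t : ℝ) (_ : t ∈ Icc (0 : ℝ) 1) =>
      MeasurableSpace.comap (fun g : Dspace => g.1 t) inferInstance) t ht

lemma FD_le {t : ℝ} (ht : t ≤ 1) : FD t ≤ (inferInstance : MeasurableSpace Dspace) := by
  refine iSup₂_le fun r hr => ?_
  exact (measurable_eval ⟨hr.1, hr.2.trans ht⟩).comap_le

lemma FD_mono {s t : ℝ} (h : s ≤ t) : FD s ≤ FD t := by
  refine iSup₂_le fun r hr => ?_
  exact le_iSup₂ (f := fun (r : ℝ) (_ : r ∈ Icc (0 : ℝ) t) =>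
      MeasurableSpace.comap (fun g : Dspace => g.1 r) inferInstance) r ⟨hr.1, hr.2.trans h⟩

lemma measurable_FD {t r : ℝ} (hr : r ∈ Icc (0 : ℝ) t) : Measurable[FD t] (fun g : Dspace => g.1 r) := by
  rw [measurable_iff_comap_le]
  exact le_iSup₂ (f := fun (r : ℝ) (_ : r ∈ Icc (0 : ℝ) t) =>
      MeasurableSpace.comap (fun g : Dspace => g.1 r) inferInstance) r hr

lemma FD_le_FDplus {s : ℝ} : FD s ≤ FDplus s := by
  unfold FDplus
  split_ifs with h
  · rw [h]
  · exact le_iInf₂ fun t ht => FD_mono ht.1.le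

lemma FDplus_le_FD {s t : ℝ} (hst : s < t) (ht : t ≤ 1) : FDplus s ≤ FD t := by
  unfold FDplus
  rw [if_neg (hst.trans_le ht).ne]
  exact iInf₂_le t ⟨hst, ht⟩

lemma FDplus_one : FDplus 1 = FD 1 := if_pos rfl

lemma FDplus_le {s : ℝ} (hs : s ≤ 1) : FDplus s ≤ (inferInstance : MeasurableSpace Dspace) := by
  rcases hs.eq_or_lt with rfl | h
  · rw [FDplus_one]; exact FD_le le_rfl
  · exact (FDplus_le_FD h le_rfl).trans (FD_le le_rfl)

lemma FDplus_mono {s t : ℝ} (hst : s ≤ t) (ht : t ≤ 1) : FDplus s ≤ FDplus t := by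
  rcases hst.eq_or_lt with rfl | h
  · exact le_rfl
  · exact (FDplus_le_FD h ht).trans FD_le_FDplus

lemma measurable_restr (hQ : Q ⊆ Icc (0 : ℝ) 1) : Measurable (restr Q) :=
  measurable_pi_lambda _ fun q => measurable_eval (hQ q.2)

lemma comap_restr_le (hQ : Q ⊆ Icc (0 : ℝ) 1) (r : ↥Q) :
    MeasurableSpace.comap (restr Q) (natFiltration ↥Q r) ≤ FD r := by
  rw [← measurable_iff_comap_le]
  intro A hA
  have : natFiltration ↥Q r ≤ MeasurableSpace.map (restr Q) (FD r) := by
    refine iSup₂_le fun t ht => ?_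
    rintro _ ⟨B, hB, rfl⟩
    exact measurable_FD (r := (t : ℝ)) ⟨(hQ t.2).1, ht⟩ hB
  exact this A hA

lemma FD_le_comap_restr (hQ : Q ⊆ Icc (0 : ℝ) 1) (hd : Icc (0 : ℝ) 1 ⊆ closure Q) (r : ↥Q) :
    FD r ≤ MeasurableSpace.comap (restr Q) (natFiltration ↥Q r) := by
  have hq : ∀ q : ↥Q, q ≤ r → Measurable[MeasurableSpace.comap (restr Q) (natFiltration ↥Q r)]
      (fun g : Dspace => g.1 q) := by
    intro q hqr B hB
    refine ⟨(fun ω : ↥Q → ℝ => ω q) ⁻¹' B, ?_, rfl⟩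
    have : MeasurableSpace.comap (fun ω : ↥Q → ℝ => ω q) inferInstance ≤ natFiltration ↥Q r :=
      le_iSup₂ (f := fun (t : ↥Q) (_ : t ∈ Set.Iic r) =>
        MeasurableSpace.comap (fun ω : ↥Q → ℝ => ω t) inferInstance) q hqr
    exact this _ ⟨B, hB, rfl⟩
  refine iSup₂_le fun t ht => ?_
  rw [← measurable_iff_comap_le]
  rcases ht.2.eq_or_lt with h | h
  · subst h; exact hq r le_rfl
  · have ht1 : t ∈ Ico (0 : ℝ) 1 := ⟨ht.1, h.trans_le (hQ r.2).2⟩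
    obtain ⟨q, hqlt, -, hqt⟩ := exists_seq_right hd ht1 h
    refine @measurable_of_tendsto_metrizable _ _ (MeasurableSpace.comap (restr Q) (natFiltration ↥Q r)) _ _ _ _
      (fun n (g : Dspace) => g.1 (q n)) _ (fun n => hq (q n) (hqlt n).2.le) ?_
    rw [tendsto_pi_nhds]
    intro g
    exact (dspace_tendsto g ht1).comp hqt

lemma instD_le_comap_restr (hQ : Q ⊆ Icc (0 : ℝ) 1) (h1 : (1 : ℝ) ∈ Q)
    (hd : Icc (0 : ℝ) 1 ⊆ closure Q) :
    (inferInstance : MeasurableSpace Dspace) ≤ MeasurableSpace.comap (restr Q) MeasurableSpace.pi :=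
  (FD_le_comap_restr hQ hd ⟨1, h1⟩).trans
    (MeasurableSpace.comap_mono ((natFiltration ↥Q).le _))

lemma restr_map_inj (hQ : Q ⊆ Icc (0 : ℝ) 1) (h1 : (1 : ℝ) ∈ Q)
    (hd : Icc (0 : ℝ) 1 ⊆ closure Q) {P P' : Measure Dspace}
    (h : P.map (restr Q) = P'.map (restr Q)) : P = P' := by
  ext A hA
  obtain ⟨B, hB, rfl⟩ := instD_le_comap_restr hQ h1 hd A hA
  rw [← Measure.map_apply (measurable_restr hQ) hB, h, Measure.map_apply (measurable_restr hQ) hB]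

end SigmaAlg
section Limits

variable {Ω : Type*} {m0 : MeasurableSpace Ω} {P : Measure Ω} [IsProbabilityMeasure P]

lemma tendsto_L1_of_closed {m : ℕ → MeasurableSpace Ω} (hm : ∀ n, m n ≤ m0) {Z Y : Ω → ℝ}
    {X : ℕ → Ω → ℝ} (hZ : Integrable Z P) (hY : Integrable Y P)
    (hX : ∀ n, X n =ᵐ[P] P[Z | m n])
    (hlim : ∀ᵐ ω ∂P, Tendsto (fun n => X n ω) atTop (𝓝 (Y ω))) :
    Tendsto (fun n => eLpNorm (X n - Y) 1 P) atTop (𝓝 0) := by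
  have hui := (hZ.uniformIntegrable_condExp hm).2.1
  refine tendsto_Lp_finite_of_tendsto_ae le_rfl (by simp) (fun n => ?_)
    (memLp_one_iff_integrable.2 hY) (hui.ae_eq fun n => (hX n).symm) hlim
  exact (integrable_condExp.congr (hX n).symm).aestronglyMeasurable

/-- derivative of `sqrt (1 + x ^ 2)`. -/
noncomputable def cfun (x : ℝ) : ℝ := x / √(1 + x ^ 2)

lemma cfun_continuous : Continuous cfun := by
  unfold cfun
  refine continuous_id.div (by fun_prop) fun x => ?_
  positivity

lemma cfun_bound (x : ℝ) : ‖cfun x‖ ≤ 1 := by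
  unfold cfun
  rw [Real.norm_eq_abs, abs_div, abs_of_nonneg (Real.sqrt_nonneg _)]
  refine div_le_one_of_le₀ ?_ (Real.sqrt_nonneg _)
  exact Real.abs_le_sqrt (by linarith)

lemma cfun_ineq (x y : ℝ) : 0 ≤ √(1 + y ^ 2) - √(1 + x ^ 2) - cfun x * (y - x) ∧
    (√(1 + y ^ 2) - √(1 + x ^ 2) - cfun x * (y - x) = 0 → y = x) := by
  have hx : 0 < √(1 + x ^ 2) := by positivity
  have hy : 0 < √(1 + y ^ 2) := by positivity
  have hx2 : √(1 + x ^ 2) ^ 2 = 1 + x ^ 2 := Real.sq_sqrt (by positivity)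
  have hy2 : √(1 + y ^ 2) ^ 2 = 1 + y ^ 2 := Real.sq_sqrt (by positivity)
  have key : √(1 + y ^ 2) - √(1 + x ^ 2) - cfun x * (y - x) =
      (√(1 + x ^ 2) * √(1 + y ^ 2) - (1 + x * y)) / √(1 + x ^ 2) := by
    unfold cfun
    field_simp
    nlinarith [hx2]
  have hprod : (√(1 + x ^ 2) * √(1 + y ^ 2)) ^ 2 = (1 + x * y) ^ 2 + (x - y) ^ 2 := by
    rw [mul_pow, hx2, hy2]; ring
  rw [key]
  constructor
  · refine div_nonneg (sub_nonneg.2 ?_) hx.le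
    refine abs_le_of_sq_le_sq' ?_ (by positivity) |>.2
    rw [hprod]; nlinarith [sq_nonneg (x - y)]
  · intro h
    rw [div_eq_zero_iff] at h
    rcases h with h | h
    · have h' : √(1 + x ^ 2) * √(1 + y ^ 2) = 1 + x * y := by linarith
      rw [h'] at hprod
      have : (x - y) ^ 2 = 0 := by linarith
      have := pow_eq_zero_iff (two_ne_zero) |>.1 this
      linarith
    · exact absurd h hx.ne'

lemma integrable_sqrt {X : Ω → ℝ} (hX : Integrable X P) :
    Integrable (fun ω => √(1 + X ω ^ 2)) P := by
  refine Integrable.mono' ((integrable_const (1 : ℝ)).add hX.abs) ?_ (Eventually.of_forall fun ω => ?_)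
  · exact (Continuous.comp_aestronglyMeasurable (g := fun x : ℝ => √(1 + x ^ 2)) (by fun_prop) hX.1)
  · rw [Real.norm_eq_abs, abs_of_nonneg (Real.sqrt_nonneg _)]
    simp only [Pi.add_apply]
    rw [Real.sqrt_le_left (by positivity)]
    nlinarith [abs_nonneg (X ω), sq_abs (X ω)]

lemma ae_eq_of_law {X Y : Ω → ℝ} (hX : Integrable X P) (hY : Integrable Y P)
    (hlaw : P.map X = P.map Y)
    (hc : ∫ ω, cfun (X ω) * Y ω ∂P = ∫ ω, cfun (X ω) * X ω ∂P) : Y =ᵐ[P] X := by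
  have hcm : AEStronglyMeasurable (fun ω => cfun (X ω)) P :=
    cfun_continuous.comp_aestronglyMeasurable hX.1
  have i1 : Integrable (fun ω => cfun (X ω) * Y ω) P :=
    hY.bdd_mul hcm (Eventually.of_forall fun ω => cfun_bound _)
  have i2 : Integrable (fun ω => cfun (X ω) * X ω) P :=
    hX.bdd_mul hcm (Eventually.of_forall fun ω => cfun_bound _)
  have e1 : ∫ ω, √(1 + X ω ^ 2) ∂P = ∫ ω, √(1 + Y ω ^ 2) ∂P := by
    have hc : Continuous (fun x : ℝ => √(1 + x ^ 2)) := by fun_prop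
    rw [← integral_map (f := fun x : ℝ => √(1 + x ^ 2)) hX.1.aemeasurable hc.aestronglyMeasurable,
      hlaw, integral_map hY.1.aemeasurable hc.aestronglyMeasurable]
  have i3 : Integrable (fun ω => √(1 + Y ω ^ 2) - √(1 + X ω ^ 2) - cfun (X ω) * (Y ω - X ω)) P := by
    simp only [mul_sub]
    exact ((integrable_sqrt hY).sub (integrable_sqrt hX)).sub (i1.sub i2)
  have h0 : ∫ ω, (√(1 + Y ω ^ 2) - √(1 + X ω ^ 2) - cfun (X ω) * (Y ω - X ω)) ∂P = 0 := by
    simp only [mul_sub]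
    have e2 := integral_sub ((integrable_sqrt hY).sub (integrable_sqrt hX)) (i1.sub i2)
    simp only [Pi.sub_apply] at e2
    rw [e2, integral_sub (integrable_sqrt hY) (integrable_sqrt hX), integral_sub i1 i2, e1, hc]
    ring
  rw [integral_eq_zero_iff_of_nonneg (fun ω => (cfun_ineq _ _).1) i3] at h0
  filter_upwards [h0] with ω hω
  exact (cfun_ineq _ _).2 hω

lemma law_of_tendsto {X : ℕ → Ω → ℝ} {Y : Ω → ℝ} {ν : ℕ → ProbabilityMeasure ℝ}
    {ν0 : ProbabilityMeasure ℝ} (hX : ∀ n, AEMeasurable (X n) P) (hY : AEMeasurable Y P)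
    (hlaw : ∀ n, P.map (X n) = (ν n : Measure ℝ)) (hν : Tendsto ν atTop (𝓝 ν0))
    (hlim : ∀ᵐ ω ∂P, Tendsto (fun n => X n ω) atTop (𝓝 (Y ω))) :
    P.map Y = (ν0 : Measure ℝ) := by
  have : IsProbabilityMeasure (P.map Y) := Measure.isProbabilityMeasure_map hY
  refine ext_of_forall_integral_eq_of_IsFiniteMeasure fun f => ?_
  have h1 := (ProbabilityMeasure.tendsto_iff_forall_integral_tendsto.1 hν) f
  have h2 : Tendsto (fun n => ∫ ω, f (X n ω) ∂P) atTop (𝓝 (∫ ω, f (Y ω) ∂P)) := by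
    refine tendsto_integral_of_dominated_convergence (fun _ => ‖f‖)
      (fun n => f.continuous.comp_aestronglyMeasurable (hX n).aestronglyMeasurable)
      (integrable_const _) (fun n => Eventually.of_forall fun ω => f.norm_coe_le_norm _) ?_
    filter_upwards [hlim] with ω hω
    exact (f.continuous.tendsto _).comp hω
  rw [integral_map hY f.continuous.aestronglyMeasurable]
  refine tendsto_nhds_unique h2 ?_
  refine h1.congr fun n => ?_
  rw [← hlaw n, integral_map (hX n) f.continuous.aestronglyMeasurable]

end Limits

section Main

variable {Q : Set ℝ} {μ : ℝ → ProbabilityMeasure ℝ}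

lemma natFiltration_measurable {q r : ↥Q} (h : q ≤ r) :
    Measurable[natFiltration ↥Q r] (fun ω : ↥Q → ℝ => ω q) := by
  rw [measurable_iff_comap_le]
  exact le_iSup₂ (f := fun (t : ↥Q) (_ : t ∈ Set.Iic r) =>
        MeasurableSpace.comap (fun ω : ↥Q → ℝ => ω t) inferInstance) q h

lemma setIntegral_restr (hQ : Q ⊆ Icc (0 : ℝ) 1) (P : Measure Dspace) {B : Set (↥Q → ℝ)}
    (hB : MeasurableSet B) (q : ↥Q) :
    ∫ ω in B, ω q ∂(P.map (restr Q)) = ∫ g in restr Q ⁻¹' B, g.1 q ∂P := by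
  rw [setIntegral_map hB (measurable_pi_apply q).aestronglyMeasurable
    (measurable_restr hQ).aemeasurable]
  rfl

lemma mapsTo_MQ (hQ : Q ⊆ Icc (0 : ℝ) 1) {P : Measure Dspace} (hP : P ∈ MI μ) :
    P.map (restr Q) ∈ MQ Q μ := by
  obtain ⟨hprob, hmarg, hint, hmart⟩ := hP
  have hr := measurable_restr hQ
  have : IsProbabilityMeasure (P.map (restr Q)) := Measure.isProbabilityMeasure_map hr.aemeasurable
  have hint' : ∀ q : ↥Q, Integrable (fun ω : ↥Q → ℝ => ω q) (P.map (restr Q)) := fun q => by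
    rw [integrable_map_measure (measurable_pi_apply q).aestronglyMeasurable hr.aemeasurable]
    exact hint q (hQ q.2)
  refine ⟨this, ⟨fun q => (natFiltration_measurable le_rfl).stronglyMeasurable, fun s t hst => ?_⟩,
    fun t => ?_⟩
  · refine (ae_eq_condExp_of_forall_setIntegral_eq ((natFiltration ↥Q).le s) (hint' t)
      (fun _ _ _ => (hint' s).integrableOn) (fun B hB _ => ?_)
      (natFiltration_measurable le_rfl).stronglyMeasurable.aestronglyMeasurable).symm
    have hB' := (natFiltration ↥Q).le s B hB
    rw [setIntegral_restr hQ P hB', setIntegral_restr hQ P hB']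
    have hA : MeasurableSet[FDplus s] (restr Q ⁻¹' B) :=
      FD_le_FDplus _ (comap_restr_le hQ s _ ⟨B, hB, rfl⟩)
    rw [← setIntegral_condExp (FDplus_le (hQ s.2).2) (hint t (hQ t.2)) hA]
    exact integral_congr_ae (ae_restrict_of_ae (hmart s t (hQ s.2).1 hst (hQ t.2).2).symm)
  · rw [Measure.map_map (measurable_pi_apply t) hr]
    exact hmarg t (hQ t.2)

lemma integrable_of_law {Ω : Type*} {m0 : MeasurableSpace Ω} {P : Measure Ω} {X : Ω → ℝ}
    {ν : Measure ℝ} (hX : AEMeasurable X P) (hlaw : P.map X = ν) (hν : Integrable (fun x => |x|) ν) :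
    Integrable X P := by
  have h1 : Integrable (fun x : ℝ => x) ν :=
    (integrable_norm_iff (by fun_prop)).1 (by simpa [Real.norm_eq_abs] using hν)
  rw [← hlaw] at h1
  exact (integrable_map_measure (by fun_prop) hX).1 h1

lemma mem_MI (hQ : Q ⊆ Icc (0 : ℝ) 1) (h1 : (1 : ℝ) ∈ Q) (hd : Icc (0 : ℝ) 1 ⊆ closure Q)
    (hmom : ∀ t ∈ Icc (0 : ℝ) 1, Integrable (fun x => |x|) (μ t : Measure ℝ))
    {P : Measure Dspace} [IsProbabilityMeasure P] (hP : P.map (restr Q) ∈ MQ Q μ)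
    (hmarg : ∀ t ∈ Icc (0 : ℝ) 1, P.map (fun g : Dspace => g.1 t) = (μ t : Measure ℝ)) :
    P ∈ MI μ := by
  have hint : ∀ t ∈ Icc (0 : ℝ) 1, Integrable (fun g : Dspace => g.1 t) P := fun t ht =>
    integrable_of_law (measurable_eval ht).aemeasurable (hmarg t ht) (hmom t ht)
  have hI1 : (1 : ℝ) ∈ Icc (0 : ℝ) 1 := ⟨zero_le_one, le_rfl⟩
  obtain ⟨hprob, hM, -⟩ := hP
  have stepA : ∀ q : ↥Q, ∀ A, MeasurableSet[FD q] A →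
      ∫ g in A, g.1 q ∂P = ∫ g in A, g.1 1 ∂P := by
    intro q A hA
    obtain ⟨B, hB, rfl⟩ := FD_le_comap_restr hQ hd q A hA
    have hB' := (natFiltration ↥Q).le q B hB
    have h2 := hM.setIntegral_eq (i := q) (j := ⟨1, h1⟩) (hQ q.2).2 hB
    rwa [setIntegral_restr hQ P hB', setIntegral_restr hQ P hB'] at h2
  have stepA' : ∀ q : ↥Q, (fun g : Dspace => g.1 q) =ᵐ[P] P[(fun g : Dspace => g.1 1) | FD q] := by
    intro q
    refine ae_eq_condExp_of_forall_setIntegral_eq (FD_le (hQ q.2).2) (hint 1 hI1)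
      (fun _ _ _ => (hint q (hQ q.2)).integrableOn) (fun A hA _ => stepA q A hA)
      (measurable_FD ⟨(hQ q.2).1, le_rfl⟩).stronglyMeasurable.aestronglyMeasurable
  have stepB : ∀ s ∈ Icc (0 : ℝ) 1, ∀ A, MeasurableSet[FDplus s] A →
      ∫ g in A, g.1 s ∂P = ∫ g in A, g.1 1 ∂P := by
    intro s hs A hA
    rcases hs.2.eq_or_lt with rfl | hlt
    · rfl
    · obtain ⟨q, hq, -, hqt⟩ := exists_seq_right hd ⟨hs.1, hlt⟩ hlt
      have hL1 := tendsto_L1_of_closed (P := P) (m := fun n => FD (q n))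
        (fun n => FD_le (hQ (q n).2).2) (hint 1 hI1) (hint s hs) (fun n => stepA' (q n))
        (Eventually.of_forall fun g => (dspace_tendsto g ⟨hs.1, hlt⟩).comp hqt)
      have h2 := tendsto_setIntegral_of_L1' (fun g : Dspace => g.1 s) (hint s hs).aestronglyMeasurable
        (Eventually.of_forall fun n => hint (q n) (hQ (q n).2)) hL1 A
      refine tendsto_nhds_unique h2 ?_
      refine tendsto_const_nhds.congr fun n => ?_
      exact (stepA (q n) A (FDplus_le_FD (hq n).1 (hQ (q n).2).2 A hA)).symm
  refine ⟨inferInstance, hmarg, hint, fun s t hs hst ht => ?_⟩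
  have hs' : s ∈ Icc (0 : ℝ) 1 := ⟨hs, hst.trans ht⟩
  have ht' : t ∈ Icc (0 : ℝ) 1 := ⟨hs.trans hst, ht⟩
  refine (ae_eq_condExp_of_forall_setIntegral_eq (FDplus_le hs'.2) (hint t ht')
    (fun _ _ _ => (hint s hs').integrableOn) (fun A hA _ => ?_) ?_).symm
  · rw [stepB s hs' A hA, stepB t ht' A (FDplus_mono hst ht A hA)]
  · exact ((measurable_FD ⟨hs, le_rfl⟩).mono FD_le_FDplus le_rfl).stronglyMeasurable.aestronglyMeasurable

lemma surj_MQ [Countable ↥Q] (hQ : Q ⊆ Icc (0 : ℝ) 1) (h1 : (1 : ℝ) ∈ Q)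
    (hd : Icc (0 : ℝ) 1 ⊆ closure Q)
    (hmom : ∀ t ∈ Icc (0 : ℝ) 1, Integrable (fun x => |x|) (μ t : Measure ℝ))
    (hrc : ∀ t ∈ Ico (0 : ℝ) 1, Tendsto μ (𝓝[>] t) (𝓝 (μ t)))
    {P : Measure (↥Q → ℝ)} (hP : P ∈ MQ Q μ) : ∃ P' ∈ MI μ, P'.map (restr Q) = P := by
  classical
  have hPQ := hP
  obtain ⟨hprob, hM, hlaw⟩ := hP
  have hgood : ∀ᵐ ω ∂P, GoodPath Q ω := by
    filter_upwards [ae_no_upcrossings hM (T := (⟨1, h1⟩ : ↥Q)) fun q => (hQ q.2).2] with ω hω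
    exact goodPath_of hd hω.1 hω.2
  obtain ⟨N, hN, hNm, hN0⟩ := exists_measurable_superset_of_null (ae_iff.1 hgood)
  have hNgood : ∀ ω, ω ∉ N → GoodPath Q ω := fun ω hω => by
    by_contra hc
    exact hω (hN hc)
  have hNae : ∀ᵐ ω ∂P, ω ∉ N := by
    rw [ae_iff]; simpa using hN0
  have hzero : CadlagOn01 (fun _ => 0) :=
    ⟨fun _ _ => tendsto_const_nhds, fun _ _ => ⟨0, tendsto_const_nhds⟩⟩
  let G : (↥Q → ℝ) → Dspace := fun ω =>
    if h : ω ∈ N then ⟨fun _ => 0, hzero⟩ else ⟨regPath Q h1 ω, regPath_cadlag hd h1 (hNgood ω h)⟩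
  have hGN : ∀ ω ∈ N, ∀ t, (G ω).1 t = 0 := fun ω hω t => by
    have : G ω = ⟨fun _ => 0, hzero⟩ := dif_pos hω
    rw [this]
  have hGNc : ∀ ω, ω ∉ N → ∀ t, (G ω).1 t = regPath Q h1 ω t := fun ω hω t => by
    have : G ω = ⟨regPath Q h1 ω, regPath_cadlag hd h1 (hNgood ω hω)⟩ := dif_neg hω
    rw [this]
  have hG1 : ∀ ω, ω ∉ N → (G ω).1 1 = ω ⟨1, h1⟩ := fun ω hω => by
    rw [hGNc ω hω, regPath, if_neg (lt_irrefl _)]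
  have hGlim : ∀ ω, ω ∉ N → ∀ t ∈ Ico (0 : ℝ) 1, Tendsto ω (rFil Q t) (𝓝 ((G ω).1 t)) := by
    intro ω hω t ht
    rw [hGNc ω hω]
    exact regPath_tendsto h1 (hNgood ω hω) ht
  have hGev : ∀ t ∈ Icc (0 : ℝ) 1, Measurable (fun ω => (G ω).1 t) := by
    intro t ht
    rcases ht.2.eq_or_lt with rfl | hlt
    · have : (fun ω => (G ω).1 1) = Nᶜ.indicator (fun ω => ω ⟨1, h1⟩) := by
        ext ω
        by_cases hω : ω ∈ N
        · simp [hω, hGN ω hω]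
        · simp [hω, hG1 ω hω]
      rw [this]
      exact (measurable_pi_apply _).indicator hNm.compl
    · obtain ⟨q, -, hq, -⟩ := exists_seq_right hd ⟨ht.1, hlt⟩ hlt
      refine measurable_of_tendsto_metrizable
        (f := fun n => Nᶜ.indicator (fun ω : ↥Q → ℝ => ω (q n)))
        (fun n => (measurable_pi_apply _).indicator hNm.compl) ?_
      rw [tendsto_pi_nhds]
      intro ω
      by_cases hω : ω ∈ N
      · simp [hω, hGN ω hω]
      · simpa [hω, Function.comp_def] using (hGlim ω hω t ⟨ht.1, hlt⟩).comp hq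
  have hG : Measurable G := by
    rw [measurable_iff_comap_le, MeasurableSpace.comap_le_iff_le_map]
    refine iSup₂_le fun t ht => ?_
    rintro _ ⟨B, hB, rfl⟩
    exact hGev t ht hB
  -- marginals
  have hGlaw : ∀ t ∈ Icc (0 : ℝ) 1, P.map (fun ω => (G ω).1 t) = (μ t : Measure ℝ) := by
    intro t ht
    rcases ht.2.eq_or_lt with rfl | hlt
    · rw [← hlaw ⟨1, h1⟩]
      refine Measure.map_congr ?_
      filter_upwards [hNae] with ω hω
      exact hG1 ω hω
    · obtain ⟨q, -, hq, hqt⟩ := exists_seq_right hd ⟨ht.1, hlt⟩ hlt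
      refine law_of_tendsto (X := fun n ω => ω (q n)) (ν := fun n => μ (q n))
        (fun n => (measurable_pi_apply _).aemeasurable) (hGev t ht).aemeasurable
        (fun n => hlaw (q n)) ((hrc t ⟨ht.1, hlt⟩).comp hqt) ?_
      filter_upwards [hNae] with ω hω
      exact (hGlim ω hω t ⟨ht.1, hlt⟩).comp hq
  have hGint : ∀ t ∈ Icc (0 : ℝ) 1, Integrable (fun ω => (G ω).1 t) P := fun t ht =>
    integrable_of_law (hGev t ht).aemeasurable (hGlaw t ht) (hmom t ht)
  -- agreement on `Q`
  have hGX : ∀ r : ↥Q, (fun ω => (G ω).1 r) =ᵐ[P] fun ω => ω r := by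
    intro r
    rcases (hQ r.2).2.eq_or_lt with heq | hlt
    · filter_upwards [hNae] with ω hω
      have : r = ⟨1, h1⟩ := Subtype.ext heq
      subst this
      exact hG1 ω hω
    · have hr : (r : ℝ) ∈ Ico (0 : ℝ) 1 := ⟨(hQ r.2).1, hlt⟩
      obtain ⟨q, hqlt, hq, -⟩ := exists_seq_right hd hr hlt
      have hcm : StronglyMeasurable[natFiltration ↥Q r] (fun ω : ↥Q → ℝ => cfun (ω r)) :=
        (cfun_continuous.measurable.comp (natFiltration_measurable le_rfl)).stronglyMeasurable
      have hcm' := hcm.mono ((natFiltration ↥Q).le r)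
      refine ae_eq_of_law (hM.integrable r) (hGint r (hQ r.2))
        ((hlaw r).trans (hGlaw r (hQ r.2)).symm) ?_
      have hL1 := tendsto_L1_of_closed (P := P) (m := fun n => natFiltration ↥Q (q n))
        (X := fun n ω => ω (q n)) (fun n => (natFiltration ↥Q).le _) (hM.integrable ⟨1, h1⟩)
        (hGint r (hQ r.2)) (fun n => (hM.2 (q n) ⟨1, h1⟩ (hQ (q n).2).2).symm) (by
          filter_upwards [hNae] with ω hω
          exact (hGlim ω hω r hr).comp hq)
      have ib : ∀ {Y : (↥Q → ℝ) → ℝ}, Integrable Y P → Integrable (fun ω => cfun (ω r) * Y ω) P :=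
        fun hY => hY.bdd_mul hcm'.aestronglyMeasurable (Eventually.of_forall fun ω => cfun_bound _)
      have h2 : Tendsto (fun n => ∫ ω, cfun (ω r) * ω (q n) ∂P) atTop
          (𝓝 (∫ ω, cfun (ω r) * (G ω).1 r ∂P)) := by
        refine tendsto_integral_of_L1' _ (ib (hGint r (hQ r.2))).aestronglyMeasurable
          (Eventually.of_forall fun n => ib (hM.integrable (q n))) ?_
        refine tendsto_of_tendsto_of_tendsto_of_le_of_le tendsto_const_nhds hL1
          (fun _ => zero_le) fun n => ?_
        refine eLpNorm_mono fun ω => ?_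
        simp only [Pi.sub_apply]
        rw [← mul_sub, norm_mul]
        exact mul_le_of_le_one_left (norm_nonneg _) (cfun_bound _)
      refine tendsto_nhds_unique h2 ?_
      refine tendsto_const_nhds.congr fun n => ?_
      have hrq : r ≤ q n := le_of_lt (hqlt n).1
      have h3 := condExp_mul_of_stronglyMeasurable_left hcm (ib (hM.integrable (q n)))
        (hM.integrable (q n))
      have h4 : ∫ ω, cfun (ω r) * ω (q n) ∂P = ∫ ω, (P[fun ω => cfun (ω r) * ω (q n) |
          natFiltration ↥Q r]) ω ∂P := (integral_condExp ((natFiltration ↥Q).le r)).symm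
      rw [h4]
      refine integral_congr_ae ?_
      filter_upwards [h3, hM.2 r (q n) hrq] with ω e1 e2
      refine Eq.symm (Eq.trans e1 ?_)
      simp only [Pi.mul_apply]
      rw [e2]
  have hrestr : (P.map G).map (restr Q) = P := by
    rw [Measure.map_map (measurable_restr hQ) hG]
    have : restr Q ∘ G =ᵐ[P] id := by
      filter_upwards [ae_all_iff.2 hGX] with ω hω
      exact funext hω
    rw [Measure.map_congr this, Measure.map_id]
  have hpr : IsProbabilityMeasure (P.map G) := Measure.isProbabilityMeasure_map hG.aemeasurable
  refine ⟨P.map G, mem_MI hQ h1 hd hmom (by rw [hrestr]; exact hPQ) fun t ht => ?_, hrestr⟩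
  rw [Measure.map_map (measurable_eval ht) hG]
  exact hGlaw t ht

end Main

/-- for a right-continuous peacock `(μ_t)_{t∈[0,1]}` and countable dense
`Q ⊆ [0,1]` with `1 ∈ Q`, restriction of paths to `Q` is a bijection between the càdlàg
martingale measures on `D` with marginals `(μ_t)_{t∈[0,1]}` and the martingale measures
on `ℝ^Q` with marginals `(μ_t)_{t∈Q}`. -/
theorem restriction_bijection
    (Q : Set ℝ) [Countable ↥Q] (hQsub : Q ⊆ Icc (0 : ℝ) 1) (h1Q : (1 : ℝ) ∈ Q)
    (hQdense : Icc (0 : ℝ) 1 ⊆ closure Q)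
    (μ : ℝ → ProbabilityMeasure ℝ)
    (hmom : ∀ t ∈ Icc (0 : ℝ) 1, Integrable (fun x => |x|) (μ t : Measure ℝ))
    (hpeacock : ∀ s t : ℝ, 0 ≤ s → s ≤ t → t ≤ 1 →
      ConvexOrder (μ s : Measure ℝ) (μ t : Measure ℝ))
    (hrc : ∀ t ∈ Ico (0 : ℝ) 1, Tendsto μ (𝓝[>] t) (𝓝 (μ t))) :
    Set.BijOn (fun P : Measure Dspace => P.map (fun g (q : ↥Q) => g.1 q))
      (MI μ) (MQ Q μ) := by
  refine ⟨fun P hP => mapsTo_MQ hQsub hP, ?_, ?_⟩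
  · intro P _ P' _ h
    exact restr_map_inj hQsub h1Q hQdense h
  · intro P hP
    obtain ⟨P', h1, h2⟩ := surj_MQ hQsub h1Q hQdense hmom hrc hP
    exact ⟨P', h1, h2⟩
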